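/- Let n ∈ ℕ, let A^{(n)} = diag(1, ζ_n, ζ_n², …, ζ_n^{n−1}) where ζ_n = e^{2πi/n}, let B ∈ M_n(ℂ), and let ε > 0. Then there exists B_ε ∈ D_ε^{(n)} such that ‖B − B_ε‖₂ ≤ (8√π / ε) · ‖A^{(n)}B − BA^{(n)}‖₂ and ‖B_ε‖ ≤ 3‖B‖. -/

import Mathlib

open Matrix

noncomputable section

/-- `n × n` complex matrices. -/
abbrev Mat (n : ℕ) := Matrix (Fin n) (Fin n) ℂ

/-- The operator norm of a matrix, i.e. its norm as an operator on `ℂⁿ` with the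
Euclidean norm. -/
noncomputable def opNorm {n : ℕ} (A : Mat n) : ℝ :=
  ‖(Matrix.toEuclideanCLM (𝕜 := ℂ) (n := Fin n) A :
      EuclideanSpace ℂ (Fin n) →L[ℂ] EuclideanSpace ℂ (Fin n))‖

/-- The normalized Hilbert--Schmidt norm `‖A‖₂ = ((1/n)·Tr(A*A))^{1/2}`. -/
noncomputable def hsNorm {n : ℕ} (A : Mat n) : ℝ :=
  Real.sqrt ((Matrix.trace (Aᴴ * A)).re / n)

/-- The diagonal matrix `A⁽ⁿ⁾ = diag(1, ζ_n, ζ_n², …, ζ_nⁿ⁻¹)`, `ζ_n = e^{2πi/n}`. -/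
noncomputable def An (n : ℕ) : Mat n :=
  Matrix.diagonal fun t => Complex.exp (2 * Real.pi * Complex.I * ((t : ℕ) : ℂ) / n)

/-- The distance between `i` and `j` modulo `n`. -/
def dmod (n : ℕ) (i j : Fin n) : ℕ :=
  min (Nat.dist i.val j.val) (n - Nat.dist i.val j.val)

/-- The band set `D_ε⁽ⁿ⁾ = {B : B_{ij} = 0 whenever d_n(i,j) > εn}`. -/
def Dband (n : ℕ) (ε : ℝ) : Set (Mat n) :=
  {B | ∀ i j, ε * n < (dmod n i j : ℝ) → B i j = 0}

lemma hs_sq {n : ℕ} (X : Mat n) :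
    (Matrix.trace (Xᴴ * X)).re = ∑ j, ∑ i, ‖X i j‖ ^ 2 := by
  simp only [Matrix.trace, Matrix.diag, Matrix.mul_apply, Matrix.conjTranspose_apply,
    Complex.re_sum]
  refine Finset.sum_congr rfl fun j _ => Finset.sum_congr rfl fun i _ => ?_
  rw [Complex.star_def, ← Complex.normSq_eq_conj_mul_self, Complex.ofReal_re,
    Complex.normSq_eq_norm_sq]

lemma hs_mono {n : ℕ} (X Y : Mat n) (c : ℝ) (hc : 0 ≤ c)
    (h : ∀ i j, ‖X i j‖ ≤ c * ‖Y i j‖) : hsNorm X ≤ c * hsNorm Y := by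
  unfold hsNorm
  rw [hs_sq, hs_sq]
  apply Real.sqrt_le_iff.2
  refine ⟨by positivity, ?_⟩
  rw [mul_pow, Real.sq_sqrt (by positivity), ← mul_div_assoc]
  gcongr
  rw [Finset.mul_sum]
  refine Finset.sum_le_sum fun j _ => ?_
  rw [Finset.mul_sum]
  refine Finset.sum_le_sum fun i _ => ?_
  rw [← mul_pow]
  exact pow_le_pow_left₀ (norm_nonneg _) (h i j) 2

lemma op_schur {n : ℕ} {ι : Type} [Fintype ι] (B : Mat n) (w : ι → Fin n → ℝ)
    (hw : ∀ i, ∑ k, w k i ^ 2 = 1) :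
    opNorm (Matrix.of fun i j => ((∑ k, w k i * w k j : ℝ) : ℂ) * B i j) ≤ opNorm B := by
  set M : Mat n := Matrix.of fun i j => ((∑ k, w k i * w k j : ℝ) : ℂ) * B i j with hM
  unfold opNorm
  set T := (Matrix.toEuclideanCLM (𝕜 := ℂ) (n := Fin n) B :
      EuclideanSpace ℂ (Fin n) →L[ℂ] EuclideanSpace ℂ (Fin n))
  set S := (Matrix.toEuclideanCLM (𝕜 := ℂ) (n := Fin n) M :
      EuclideanSpace ℂ (Fin n) →L[ℂ] EuclideanSpace ℂ (Fin n))
  let P : ι → EuclideanSpace ℂ (Fin n) → EuclideanSpace ℂ (Fin n) :=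
    fun k x => WithLp.toLp 2 (fun i => (w k i : ℂ) * x i)
  have hP : ∀ x, ∑ k, ‖P k x‖ ^ 2 = ‖x‖ ^ 2 := by
    intro x
    simp only [EuclideanSpace.norm_sq_eq, P, norm_mul, mul_pow, Complex.norm_real,
      Real.norm_eq_abs, sq_abs]
    rw [Finset.sum_comm]
    refine Finset.sum_congr rfl fun i _ => ?_
    rw [← Finset.sum_mul, hw, one_mul]
  have hin : ∀ x y, inner ℂ y (S x) = ∑ k, inner ℂ (P k y) (T (P k x)) := by
    intro x y
    simp only [PiLp.inner_apply, S, T, Matrix.ofLp_toEuclideanCLM, P, RCLike.inner_apply,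
      Matrix.mulVec, dotProduct, hM, Matrix.of_apply, map_mul, Complex.conj_ofReal,
      Complex.ofReal_sum, Complex.ofReal_mul, Finset.sum_mul]
    rw [Finset.sum_comm]
    rw [Finset.sum_comm (s := Finset.univ (α := ι))]
    rw [Finset.sum_comm]
    refine Finset.sum_congr rfl fun i _ => ?_
    rw [Finset.sum_comm]
    refine Finset.sum_congr rfl fun i _ => ?_
    refine Finset.sum_congr rfl fun i _ => ?_
    ring
  have hb : ∀ x y, ‖inner ℂ y (S x)‖ ≤ ‖T‖ * (‖x‖ * ‖y‖) := by
    intro x y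
    rw [hin]
    calc ‖∑ k, inner ℂ (P k y) (T (P k x))‖ ≤ ∑ k, ‖T‖ * (‖P k x‖ * ‖P k y‖) := by
          refine (norm_sum_le _ _).trans (Finset.sum_le_sum fun k _ => ?_)
          refine (norm_inner_le_norm _ _).trans ?_
          have := T.le_opNorm (P k x)
          nlinarith [norm_nonneg (P k y)]
      _ = ‖T‖ * ∑ k, ‖P k x‖ * ‖P k y‖ := by rw [Finset.mul_sum]
      _ ≤ ‖T‖ * (‖x‖ * ‖y‖) := by
          gcongr
          refine (Real.sum_mul_le_sqrt_mul_sqrt _ _ _).trans ?_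
          rw [hP, hP, Real.sqrt_sq (norm_nonneg _), Real.sqrt_sq (norm_nonneg _)]
  refine S.opNorm_le_bound (norm_nonneg _) fun x => ?_
  have h := hb x (S x)
  rw [inner_self_eq_norm_sq_to_K, norm_pow] at h
  simp only [Complex.coe_algebraMap, RCLike.norm_ofReal, abs_norm, Complex.norm_real, norm_norm] at h
  by_cases h0 : ‖S x‖ = 0
  · rw [h0]; positivity
  · have : 0 < ‖S x‖ := lt_of_le_of_ne (norm_nonneg _) (Ne.symm h0)
    nlinarith

lemma sub_cases {n : ℕ} (a b : Fin n) :
    (b.val ≤ a.val ∧ (a - b).val = a.val - b.val) ∨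
    (a.val < b.val ∧ (a - b).val = a.val + n - b.val) := by
  have ha := a.isLt
  have hb := b.isLt
  rw [Fin.sub_def]
  simp only
  rcases Nat.lt_or_ge a.val b.val with h | h
  · right
    refine ⟨h, ?_⟩
    rw [Nat.mod_eq_of_lt (by omega)]; omega
  · left
    refine ⟨h, ?_⟩
    rw [Nat.mod_eq_sub_mod (by omega), Nat.mod_eq_of_lt (by omega)]; omega

lemma dmod_eq {n : ℕ} (i j : Fin n) : dmod n i j = min (i - j).val (j - i).val := by
  have ha := i.isLt
  have hb := j.isLt
  unfold dmod Nat.dist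
  rcases sub_cases i j with h | h <;> rcases sub_cases j i with h' | h' <;> omega

lemma card_win {n : ℕ} (m : ℕ) (hm : m ≤ n) (i : Fin n) :
    (Finset.univ.filter fun k : Fin n => (i - k).val < m).card = m := by
  haveI : NeZero n := ⟨by have := i.isLt; omega⟩
  have : (Finset.univ.filter fun k : Fin n => (i - k).val < m).card
      = (Finset.univ.filter fun k : Fin n => k.val < m).card := by
    refine Finset.card_bij' (fun k _ => i - k) (fun k _ => i - k) ?_ ?_ ?_ ?_ <;> simp
  rw [this, Fin.card_filter_val_lt]; omega

lemma win_diff {n : ℕ} (m : ℕ) (i j : Fin n) :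
    (Finset.univ.filter fun k : Fin n => (i - k).val < m ∧ ¬ (j - k).val < m).card
      ≤ (j - i).val := by
  rw [← Finset.card_range (j - i).val]
  refine Finset.card_le_card_of_injOn (fun k => m - 1 - (i - k).val) ?_ ?_
  · intro k hk
    have hk' : (i - k).val < m ∧ ¬ (j - k).val < m := by simpa using hk
    have h1 := i.isLt
    have h2 := j.isLt
    have h3 := k.isLt
    simp only [Finset.coe_range, Set.mem_Iio]
    rcases sub_cases i k with h | h <;> rcases sub_cases j k with h' | h' <;>
      rcases sub_cases j i with h'' | h'' <;> omega
  · intro k hk l hl hkl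
    have hk' : (i - k).val < m ∧ ¬ (j - k).val < m := by simpa using hk
    have hl' : (i - l).val < m ∧ ¬ (j - l).val < m := by simpa using hl
    have h1 := i.isLt
    have h2 := l.isLt
    have h3 := k.isLt
    simp only at hkl
    apply Fin.ext
    rcases sub_cases i k with h | h <;> rcases sub_cases i l with h' | h' <;> omega

def NN {n : ℕ} (m : ℕ) (i j : Fin n) : ℕ :=
  (Finset.univ.filter fun k : Fin n => (i - k).val < m ∧ (j - k).val < m).card

lemma NN_add {n : ℕ} (m : ℕ) (hm : m ≤ n) (i j : Fin n) : NN m i j +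
    (Finset.univ.filter fun k : Fin n => (i - k).val < m ∧ ¬ (j - k).val < m).card = m := by
  have := Finset.card_filter_add_card_filter_not (s := Finset.univ.filter fun k : Fin n => (i - k).val < m)
    (fun k => (j - k).val < m)
  rw [card_win m hm, Finset.filter_filter, Finset.filter_filter] at this
  exact this

lemma NN_comm {n : ℕ} (m : ℕ) (i j : Fin n) : NN m i j = NN m j i := by
  unfold NN
  congr 1
  ext k
  simp [and_comm]

lemma NN_ge {n : ℕ} (m : ℕ) (hm : m ≤ n) (i j : Fin n) : m ≤ NN m i j + dmod n i j := by
  have h1 := NN_add m hm i j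
  have h2 := NN_add m hm j i
  have h3 := win_diff m i j
  have h4 := win_diff m j i
  rw [NN_comm m j i] at h2
  rw [dmod_eq]
  omega

lemma NN_zero {n : ℕ} (m : ℕ) (i j : Fin n) (h : m ≤ dmod n i j) : NN m i j = 0 := by
  unfold NN
  rw [Finset.card_eq_zero, Finset.filter_eq_empty_iff]
  rintro k - ⟨ha, hb⟩
  rw [dmod_eq] at h
  have h1 := i.isLt
  have h2 := j.isLt
  have h3 := k.isLt
  rcases sub_cases i k with h | h <;> rcases sub_cases j k with h' | h' <;>
      rcases sub_cases j i with h'' | h'' <;> rcases sub_cases i j with h''' | h''' <;> omega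

lemma sin_ge {n : ℕ} (D : ℕ) (hD : D < n) :
    2 * ((min D (n - D) : ℕ) : ℝ) / n ≤ Real.sin (Real.pi * D / n) := by
  have hn : (0 : ℝ) < n := by exact_mod_cast (by omega : 0 < n)
  have key : ∀ E : ℕ, 2 * E ≤ n → 2 * (E : ℝ) / n ≤ Real.sin (Real.pi * E / n) := by
    intro E hE
    have hE' : 2 * (E : ℝ) ≤ n := by exact_mod_cast hE
    have := Real.mul_le_sin (x := Real.pi * E / n) (by positivity) (by
      rw [div_le_div_iff₀ hn two_pos]; nlinarith [Real.pi_pos])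
    refine le_trans (le_of_eq ?_) this
    field_simp
  rcases Nat.lt_or_ge n (2 * D) with h | h
  · rw [min_eq_right (by omega)]
    refine (key (n - D) (by omega)).trans (le_of_eq ?_)
    rw [← Real.sin_pi_sub, Nat.cast_sub hD.le]
    congr 1
    field_simp
    ring
  · rw [min_eq_left (by omega)]
    exact key D h

lemma zeta_ge {n : ℕ} (i j : Fin n) :
    4 * (dmod n i j : ℝ) / n ≤
      ‖Complex.exp (2 * Real.pi * Complex.I * ((i : ℕ) : ℂ) / n) -
        Complex.exp (2 * Real.pi * Complex.I * ((j : ℕ) : ℂ) / n)‖ := by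
  have main : ∀ a b : ℕ, b ≤ a → a < n →
      4 * ((min (a - b) (n - (a - b)) : ℕ) : ℝ) / n ≤
      ‖Complex.exp (2 * Real.pi * Complex.I * (a : ℂ) / n) -
        Complex.exp (2 * Real.pi * Complex.I * (b : ℂ) / n)‖ := by
    intro a b hba han
    have h := sin_ge (n := n) (a - b) (by omega)
    have e : Complex.exp (2 * Real.pi * Complex.I * (a : ℂ) / n) -
        Complex.exp (2 * Real.pi * Complex.I * (b : ℂ) / n) =
        Complex.exp (((2 * Real.pi * b / n : ℝ) : ℂ) * Complex.I) *
         (Complex.exp (Complex.I * ((2 * Real.pi * ((a - b : ℕ) : ℝ) / n : ℝ) : ℂ)) - 1) := by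
      rw [mul_sub, ← Complex.exp_add, mul_one]
      push_cast [Nat.cast_sub hba]
      congr 2 <;> ring
    rw [e, norm_mul, Complex.norm_exp_ofReal_mul_I, one_mul,
      Complex.norm_exp_I_mul_ofReal_sub_one]
    rw [Real.norm_eq_abs]
    refine le_trans ?_ (le_abs_self _)
    have : 2 * Real.pi * ((a - b : ℕ) : ℝ) / n / 2 = Real.pi * ((a - b : ℕ) : ℝ) / n := by ring
    rw [this]
    calc _ = 2 * (2 * ((min (a - b) (n - (a - b)) : ℕ) : ℝ) / n) := by ring
      _ ≤ _ := by gcongr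
  have hi := i.isLt
  have hj := j.isLt
  rcases le_total j.val i.val with h | h
  · have := main i j h hi
    unfold dmod
    rwa [Nat.dist_eq_sub_of_le_right h]
  · have := main j i h hj
    unfold dmod
    rw [Nat.dist_eq_sub_of_le h, norm_sub_rev]
    exact this

/-- For every `B ∈ M_n(ℂ)` and `ε > 0` there exists `B_ε ∈ D_ε⁽ⁿ⁾` with
`‖B − B_ε‖₂ ≤ (8√π/ε)·‖A⁽ⁿ⁾B − BA⁽ⁿ⁾‖₂` and `‖B_ε‖ ≤ 3‖B‖`. -/
theorem stmt_4 (n : ℕ) (B : Mat n) (ε : ℝ) (hε : 0 < ε) :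
    ∃ Bε ∈ Dband n ε,
      hsNorm (B - Bε) ≤ (8 * Real.sqrt Real.pi / ε) * hsNorm (An n * B - B * An n) ∧
      opNorm Bε ≤ 3 * opNorm B := by
  have hpi : (1 : ℝ) ≤ Real.sqrt Real.pi := by
    rw [Real.one_le_sqrt]; linarith [Real.pi_gt_three]
  by_cases hm : ⌊ε * n⌋₊ + 1 ≤ n
  swap
  · refine ⟨B, ?_, ?_, ?_⟩
    · intro i j h
      exfalso
      have h1 : (n : ℝ) ≤ ε * n := (Nat.cast_le.2 (by omega : n ≤ ⌊ε * n⌋₊)).trans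
        (Nat.floor_le (by positivity))
      have h2 : dmod n i j ≤ n := by
        unfold dmod; omega
      have h3 : (dmod n i j : ℝ) ≤ n := by exact_mod_cast h2
      linarith
    · have : hsNorm (B - B) = 0 := by simp [hsNorm]
      rw [this]
      unfold hsNorm
      positivity
    · have : 0 ≤ opNorm B := norm_nonneg _
      linarith
  set m := ⌊ε * n⌋₊ + 1 with hmdef
  have hn : (0 : ℝ) < n := by exact_mod_cast (by omega : 0 < n)
  have hm0 : (0 : ℝ) < m := by exact_mod_cast (by omega : 0 < m)
  have hmε : ε * n ≤ m := by
    rw [hmdef]; push_cast; exact (Nat.lt_floor_add_one _).le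
  let w : Fin n → Fin n → ℝ := fun k i => if (i - k).val < m then 1 / Real.sqrt m else 0
  have hww : ∀ i j, ∑ k, w k i * w k j = NN m i j / m := by
    intro i j
    have : ∀ k, w k i * w k j = if (i - k).val < m ∧ (j - k).val < m then 1 / (m : ℝ) else 0 := by
      intro k
      simp only [w]
      by_cases h1 : (i - k).val < m <;> by_cases h2 : (j - k).val < m <;> simp [h1, h2]
      rw [← mul_inv, Real.mul_self_sqrt hm0.le]
    simp only [this]
    rw [← Finset.sum_filter, Finset.sum_const, nsmul_eq_mul, NN]
    ring
  refine ⟨Matrix.of fun i j => ((∑ k, w k i * w k j : ℝ) : ℂ) * B i j, ?_, ?_, ?_⟩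
  · intro i j h
    have h1 : m ≤ dmod n i j := by
      rw [hmdef, Nat.succ_le_iff, Nat.floor_lt (by positivity)]
      exact h
    simp only [Matrix.of_apply]
    rw [hww, NN_zero m i j h1]
    simp
  · apply hs_mono _ _ _ (by positivity)
    intro i j
    have hL : (B - Matrix.of fun i j => ((∑ k, w k i * w k j : ℝ) : ℂ) * B i j) i j
        = ((1 - (NN m i j : ℝ) / m : ℝ) : ℂ) * B i j := by
      rw [Matrix.sub_apply, Matrix.of_apply, hww]
      push_cast
      ring
    have hR : (An n * B - B * An n) i j =
       (Complex.exp (2 * Real.pi * Complex.I * ((i : ℕ) : ℂ) / n) -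
        Complex.exp (2 * Real.pi * Complex.I * ((j : ℕ) : ℂ) / n)) * B i j := by
      simp only [An, Matrix.sub_apply, Matrix.diagonal_mul, Matrix.mul_diagonal]
      ring
    rw [hL, hR, norm_mul, norm_mul, ← mul_assoc]
    gcongr
    have h1 : NN m i j ≤ m := by
      have := NN_add m hm i j; omega
    have h2 := NN_ge m hm i j
    have h1' : (NN m i j : ℝ) ≤ m := by exact_mod_cast h1
    have h2' : (m : ℝ) ≤ NN m i j + dmod n i j := by exact_mod_cast h2
    have h3 : 1 - (NN m i j : ℝ) / m = (m - NN m i j) / m := by field_simp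
    rw [Complex.norm_real, Real.norm_eq_abs, h3, abs_of_nonneg (by
      apply div_nonneg <;> linarith)]
    calc ((m : ℝ) - NN m i j) / m ≤ dmod n i j / (ε * n) := by
          apply div_le_div₀ <;> first | positivity | linarith
      _ = (1 / (4 * ε)) * (4 * (dmod n i j : ℝ) / n) := by field_simp
      _ ≤ (8 * Real.sqrt Real.pi / ε) * (4 * (dmod n i j : ℝ) / n) := by
          gcongr ?_ * _
          rw [div_le_div_iff₀ (by positivity) hε]
          nlinarith
      _ ≤ _ := by
          gcongr
          exact zeta_ge i j
  · refine (op_schur B w ?_).trans ?_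
    · intro i
      have := hww i i
      simp only [← pow_two] at this
      rw [this]
      have h2 : NN m i i = m := by
        unfold NN
        simp only [and_self]
        exact card_win m hm i
      rw [h2]
      field_simp
    · have : 0 ≤ opNorm B := norm_nonneg _
      linarith

end
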